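/- Let k ∈ ℤ with 1 ≤ k ≤ n−1, let V ⊂ ℝⁿ be a k-dimensional linear subspace, and let x ∈ ℝⁿ with x ≠ 0. Suppose a Radon measure μ on ℝⁿ×ℝ is backwardly self-similar at 0^{n,1} := (0,0) and at (x,0), and is backwardly invariant with respect to V. Then μ is backwardly invariant with respect to the subspace span(V ∪ {x}); in particular, if x ∉ V, then μ is backwardly invariant with respect to a (k+1)-dimensional subspace. -/

import Mathlib

noncomputable section

open MeasureTheory Metric Set Filter Topology Real

abbrev Eu (n : ℕ) : Type := EuclideanSpace ℝ (Fin n)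
abbrev Spt (n : ℕ) : Type := Eu n × ℝ

/-- The parabolic ball `P_r(X) = B_r(x) × (t - r², t + r²)`. -/
def pball {n : ℕ} (X : Spt n) (r : ℝ) : Set (Spt n) :=
  Metric.ball X.1 r ×ˢ Set.Ioo (X.2 - r ^ 2) (X.2 + r ^ 2)

/-- Time partial derivative of a test function. -/
def dtime {n : ℕ} (θ : Spt n → ℝ) (p : Spt n) : ℝ := fderiv ℝ θ p ((0 : Eu n), (1 : ℝ))

/-- Spatial partial derivative of a test function. -/
def dsp {n : ℕ} (θ : Spt n → ℝ) (i : Fin n) (p : Spt n) : ℝ :=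
  fderiv ℝ θ p (EuclideanSpace.single i (1 : ℝ), (0 : ℝ))

/-- `|∇u|²`, where `du p i a` is the weak derivative `∂ᵢ u^a (p)`. -/
def gradSq {n d : ℕ} (du : Spt n → Fin n → Fin d → ℝ) (p : Spt n) : ℝ :=
  ∑ i, ∑ a, du p i a ^ 2

/-- `|∂ₜ u|²`, where `ut p a` is the weak derivative `∂ₜ u^a (p)`. -/
def timeSq {n d : ℕ} (ut : Spt n → Fin d → ℝ) (p : Spt n) : ℝ := ∑ a, ut p a ^ 2


/-- The set of backward times `ℝⁿ × ℝ₋`. -/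
def negTimes (n : ℕ) : Set (Spt n) := {p : Spt n | p.2 < 0}

/-- The parabolic rescaling `T_{X,λ}μ (A) = λ^{-n} μ (𝒫_{X,λ}^{-1}(A))`,
where `𝒫_{X,λ}^{-1}(y,s) = (x + λ y, t + λ² s)`. -/
def scaledMeas {n : ℕ} (X : Spt n) (l : ℝ) (μ : Measure (Spt n)) : Measure (Spt n) :=
  (ENNReal.ofReal (l⁻¹ ^ n)) •
    Measure.map (fun p : Spt n => (l⁻¹ • (p.1 - X.1), (p.2 - X.2) / l ^ 2)) μ

/-- `μ` is backwardly self-similar at `X`. -/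
def BackSelfSimilarMeas {n : ℕ} (μ : Measure (Spt n)) (X : Spt n) : Prop :=
  ∀ l : ℝ, 0 < l →
    (scaledMeas X l μ).restrict (negTimes n) = (scaledMeas X 1 μ).restrict (negTimes n)

/-- `μ` is backwardly invariant with respect to a linear subspace `V ⊆ ℝⁿ`:
the translate `μ(· + (v,0))` agrees with `μ` on `ℝⁿ × ℝ₋` for every `v ∈ V`. -/
def BackInvariantMeas {n : ℕ} (μ : Measure (Spt n)) (V : Submodule ℝ (Eu n)) : Prop :=
  ∀ v ∈ V,
    (Measure.map (fun p : Spt n => (p.1 - v, p.2)) μ).restrict (negTimes n)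
      = μ.restrict (negTimes n)

/-- Spatial translation. -/
def tau {n : ℕ} (v : Eu n) (p : Spt n) : Spt n := (p.1 - v, p.2)

/-- Set-level invariance under translation by one vector. -/
def Inv1 {n : ℕ} (μ : Measure (Spt n)) (v : Eu n) : Prop :=
  ∀ A : Set (Spt n), MeasurableSet A → A ⊆ negTimes n → μ (tau v ⁻¹' A) = μ A

lemma meas_neg (n : ℕ) : MeasurableSet (negTimes n) :=
  measurableSet_lt measurable_snd measurable_const

lemma meas_tau {n : ℕ} (v : Eu n) : Measurable (tau v) := by
  unfold tau; fun_prop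

lemma restrict_eq_iff' {n : ℕ} (μ ν : Measure (Spt n)) :
    μ.restrict (negTimes n) = ν.restrict (negTimes n) ↔
      ∀ A : Set (Spt n), MeasurableSet A → A ⊆ negTimes n → μ A = ν A := by
  constructor
  · intro h A hA hs
    have := congrArg (fun m => m A) h
    simpa [Measure.restrict_apply hA, inter_eq_left.mpr hs] using this
  · intro h
    ext A hA
    rw [Measure.restrict_apply hA, Measure.restrict_apply hA]
    exact h _ (hA.inter (meas_neg n)) inter_subset_right

lemma backInvariant_iff {n : ℕ} (μ : Measure (Spt n)) (V : Submodule ℝ (Eu n)) :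
    BackInvariantMeas μ V ↔ ∀ v ∈ V, Inv1 μ v := by
  unfold BackInvariantMeas Inv1
  refine forall₂_congr fun v _ => ?_
  rw [restrict_eq_iff']
  refine forall₃_congr fun A hA _ => ?_
  rw [show (fun p : Spt n => (p.1 - v, p.2)) = tau v from rfl,
    Measure.map_apply (meas_tau v) hA]

lemma tau_comp {n : ℕ} (v w : Eu n) (A : Set (Spt n)) :
    tau v ⁻¹' (tau w ⁻¹' A) = tau (v + w) ⁻¹' A := by
  ext p
  simp only [mem_preimage, tau, sub_sub]

lemma tau_neg {n : ℕ} (v : Eu n) {A : Set (Spt n)} (h : A ⊆ negTimes n) :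
    tau v ⁻¹' A ⊆ negTimes n := by
  intro p hp
  have h1 : tau v p ∈ negTimes n := h hp
  exact h1

lemma tau_zero {n : ℕ} (A : Set (Spt n)) : tau 0 ⁻¹' A = A := by
  ext p
  simp [tau]

lemma Inv1.add {n : ℕ} {μ : Measure (Spt n)} {v w : Eu n} (hv : Inv1 μ v) (hw : Inv1 μ w) :
    Inv1 μ (v + w) := by
  intro A hA hs
  rw [← tau_comp, hv _ (meas_tau w hA) (tau_neg w hs), hw A hA hs]

lemma Inv1.neg {n : ℕ} {μ : Measure (Spt n)} {v : Eu n} (hv : Inv1 μ v) : Inv1 μ (-v) := by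
  intro A hA hs
  rw [← hv _ (meas_tau (-v) hA) (tau_neg _ hs), tau_comp, add_neg_cancel, tau_zero]

/-- Parabolic dilation. -/
def dil {n : ℕ} (l : ℝ) (p : Spt n) : Spt n := (l⁻¹ • p.1, p.2 / l ^ 2)

lemma meas_dil {n : ℕ} (l : ℝ) : Measurable (dil (n := n) l) := by
  unfold dil; fun_prop

lemma selfSim_sets {n : ℕ} {μ : Measure (Spt n)} {y : Eu n}
    (h : BackSelfSimilarMeas μ (y, 0)) (l : ℝ) (hl : 0 < l) (A : Set (Spt n))
    (hA : MeasurableSet A) (hs : A ⊆ negTimes n) :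
    ENNReal.ofReal (l⁻¹ ^ n) * μ (dil l ⁻¹' (tau (l⁻¹ • y) ⁻¹' A)) = μ (tau y ⁻¹' A) := by
  have key := (restrict_eq_iff' _ _).1 (h l hl) A hA hs
  have e : ∀ m : ℝ, (fun p : Spt n => (m⁻¹ • (p.1 - y), (p.2 - 0) / m ^ 2))
      = tau (m⁻¹ • y) ∘ dil m := by
    intro m
    funext p
    simp [tau, dil, smul_sub]
  have d1 : dil (n := n) 1 = id := by
    funext p
    simp [dil]
  simp only [scaledMeas, e, Measure.smul_apply, smul_eq_mul] at key
  rw [Measure.map_apply ((meas_tau _).comp (meas_dil _)) hA,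
    Measure.map_apply ((meas_tau _).comp (meas_dil _)) hA, d1] at key
  simpa [preimage_comp] using key

lemma inv1_smul {n : ℕ} {μ : Measure (Spt n)} {x : Eu n}
    (h0 : BackSelfSimilarMeas μ ((0 : Eu n), (0 : ℝ)))
    (hx : BackSelfSimilarMeas μ (x, 0)) (c : ℝ) : Inv1 μ (c • x) := by
  have pos : ∀ c : ℝ, -1 < c → Inv1 μ (c • x) := by
    intro c hc A hA hs
    have hl : 0 < (1 + c)⁻¹ := inv_pos.mpr (by linarith)
    have hB := meas_tau (-x) hA
    have hBs := tau_neg (-x) hs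
    have a := selfSim_sets hx _ hl _ hB hBs
    have b := selfSim_sets h0 _ hl _ (meas_tau ((1 + c) • x) hB) (tau_neg _ hBs)
    rw [inv_inv] at a b
    rw [smul_zero, tau_zero, a, tau_comp, tau_comp, add_neg_cancel, tau_zero] at b
    rw [b]
    congr 3
    rw [add_smul, one_smul]
    abel
  rcases lt_or_ge (-1) c with h | h
  · exact pos c h
  · have := (pos (-c) (by linarith)).neg
    simpa using this

/-- Corollary 2.10, measure version.
If a Radon measure `μ` is backwardly self-similar at `(0,0)` and at `(x,0)` with
`x ≠ 0`, and backwardly invariant with respect to a `k`-dimensional subspace `V`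
(`1 ≤ k ≤ n-1`), then `μ` is backwardly invariant with respect to `span (V ∪ {x})`;
in particular, if `x ∉ V`, `μ` is backwardly invariant with respect to some
`(k+1)`-dimensional subspace. -/
theorem statement10 {n : ℕ} (k : ℕ) (hk1 : 1 ≤ k) (hk2 : k ≤ n - 1)
    (V : Submodule ℝ (Eu n)) (hV : Module.finrank ℝ V = k)
    (x : Eu n) (hx0 : x ≠ 0)
    (μ : Measure (Spt n)) [IsLocallyFiniteMeasure μ]
    (h0 : BackSelfSimilarMeas μ ((0 : Eu n), (0 : ℝ)))
    (hx : BackSelfSimilarMeas μ (x, 0))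
    (hinv : BackInvariantMeas μ V) :
    BackInvariantMeas μ (V ⊔ Submodule.span ℝ {x}) ∧
      (x ∉ V → ∃ W : Submodule ℝ (Eu n), Module.finrank ℝ W = k + 1 ∧
        BackInvariantMeas μ W) := by
  have main : BackInvariantMeas μ (V ⊔ Submodule.span ℝ {x}) := by
    rw [backInvariant_iff] at hinv ⊢
    intro v hv
    obtain ⟨a, ha, b, hb, rfl⟩ := Submodule.mem_sup.1 hv
    obtain ⟨c, rfl⟩ := Submodule.mem_span_singleton.1 hb
    exact (hinv a ha).add (inv1_smul h0 hx c)
  refine ⟨main, fun hxV => ⟨_, ?_, main⟩⟩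
  have hd : Disjoint V (Submodule.span ℝ {x}) :=
    (Submodule.disjoint_span_singleton' hx0).2 hxV
  have := Submodule.finrank_sup_add_finrank_inf_eq V (Submodule.span ℝ {x})
  rw [hd.eq_bot, finrank_bot, finrank_span_singleton hx0, hV] at this
  simpa using this
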